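/- arXiv:2509.24596 — 2 statements merged into one kernel-verified Lean document; each statement's English description precedes it below -/
import Mathlib

section
/- For every Polish space X, the path-connectedness equivalence relation ≈_X is an analytic subset of X × X; that is, the set {(x,y) ∈ X × X : there exists a continuous f : [0,1] → X with f(0) = x and f(1) = y} is analytic. -/
/-- The space of continuous maps from a compact second-countable space to a Polish space, with the
compact-open topology, is Polish. -/
theorem ContinuousMap.polishSpace_of_compactSpace (K X : Type*) [TopologicalSpace K]
    [CompactSpace K] [LocallyCompactSpace K] [SecondCountableTopology K]
    [TopologicalSpace X] [PolishSpace X] : PolishSpace C(K, X) := by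
  let := TopologicalSpace.upgradeIsCompletelyMetrizable X
  infer_instance

/-- For every Polish space `X`, the path-connectedness relation
`{(x,y) : ∃ continuous f : [0,1] → X, f 0 = x ∧ f 1 = y}` is an analytic
subset of `X × X`. -/
theorem statement0 (X : Type) [TopologicalSpace X] [PolishSpace X] :
    MeasureTheory.AnalyticSet
      {p : X × X | ∃ f : C(unitInterval, X), f 0 = p.1 ∧ f 1 = p.2} := by
  have := ContinuousMap.polishSpace_of_compactSpace unitInterval X
  have h : {p : X × X | ∃ f : C(unitInterval, X), f 0 = p.1 ∧ f 1 = p.2} =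
      Set.range fun f : C(unitInterval, X) => (f 0, f 1) := by
    ext p
    simp [Prod.ext_iff]
  rw [h]
  exact MeasureTheory.analyticSet_range_of_polishSpace
    ((continuous_eval_const 0).prodMk (continuous_eval_const 1))
end

section
/- Let X be a standard Borel space and E a Borel equivalence relation on X. Suppose there exists a Borel symmetric irreflexive relation G ⊆ X × X (a Borel graph) such that every vertex has at most 2 neighbors and the connected components of G are exactly the E-classes. Then E is hyperfinite. -/
/-- `E` is a Borel equivalence relation on the measurable space `X`. -/
def IsBorelEquivRel {X : Type} [MeasurableSpace X] (E : X → X → Prop) : Prop :=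
  Equivalence E ∧ MeasurableSet {p : X × X | E p.1 p.2}

/-- A finite Borel equivalence relation: every class is finite. -/
def IsFiniteBorelEquivRel {X : Type} [MeasurableSpace X] (E : X → X → Prop) : Prop :=
  IsBorelEquivRel E ∧ ∀ x, {y | E x y}.Finite

/-- `E` is hyperfinite: an increasing union of finite Borel equivalence relations. -/
def IsHyperfinite {X : Type} [MeasurableSpace X] (E : X → X → Prop) : Prop :=
  ∃ F : ℕ → X → X → Prop,
    (∀ n, IsFiniteBorelEquivRel (F n)) ∧
    (∀ n x y, F n x y → F (n + 1) x y) ∧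
    (∀ x y, E x y ↔ ∃ n, F n x y)

/-- Borel reducibility of `E` to `F`. -/
def IsBorelReducible {X Y : Type} [MeasurableSpace X] [MeasurableSpace Y]
    (E : X → X → Prop) (F : Y → Y → Prop) : Prop :=
  ∃ f : X → Y, Measurable f ∧ ∀ x y, E x y ↔ F (f x) (f y)

/-- `E` is essentially hyperfinite: Borel reducible to a hyperfinite Borel
equivalence relation on some standard Borel space. -/
def IsEssentiallyHyperfinite {X : Type} [MeasurableSpace X] (E : X → X → Prop) : Prop :=
  ∃ (Y : Type) (mY : MeasurableSpace Y), @StandardBorelSpace Y mY ∧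
    ∃ F : Y → Y → Prop, @IsBorelEquivRel Y mY F ∧ @IsHyperfinite Y mY F ∧
      @IsBorelReducible X Y _ mY E F

open Set Filter MeasureTheory

/-- The relation joining `u` to `f u` and to `g u`. -/
def StepRel {X : Type} (f g : X → X) (u v : X) : Prop := v = f u ∨ v = g u

/-- `StepRel f g` restricted to the vertices at which `r` is at most `n`. -/
def BoundedStepRel {X : Type} (f g : X → X) (r : X → ℕ) (n : ℕ) (u v : X) : Prop :=
  StepRel f g u v ∧ r u ≤ n ∧ r v ≤ n

open Classical in
/-- Move one step along a directed edge, without turning back unless forced to. -/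
noncomputable def advance {X : Type} (f g : X → X) (s : X × X) : X × X :=
  (s.2, if f s.2 = s.1 then g s.2 else f s.2)

/-- The lower limit of `φ` along the walk that starts with the directed edge `s`. -/
noncomputable def walkLiminf {X : Type} (φ : X → ℝ) (f g : X → X) (s : X × X) : ℝ :=
  liminf (fun k ↦ φ ((advance f g)^[k] s).1) atTop

/-- A vertex has high level when its `φ`-value is close, but not equal, to the lower limit of `φ`
along one of the two walks leaving it. -/
noncomputable def walkLevel {X : Type} (φ : X → ℝ) (f g : X → X) (x : X) : ℕ :=
  max ⌊|φ x - walkLiminf φ f g (x, f x)|⁻¹⌋₊ ⌊|φ x - walkLiminf φ f g (x, g x)|⁻¹⌋₊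

section Walk

variable {X : Type} {f g : X → X}

theorem advance_iterate_succ_fst (s : X × X) (k : ℕ) :
    ((advance f g)^[k + 1] s).1 = ((advance f g)^[k] s).2 := by
  rw [Function.iterate_succ_apply']; rfl

theorem stepRel_advance (s : X × X) : StepRel f g (advance f g s).1 (advance f g s).2 := by
  unfold advance StepRel
  dsimp only
  split_ifs
  · exact Or.inr rfl
  · exact Or.inl rfl

theorem stepRel_advance_iterate {s : X × X} (hs : StepRel f g s.1 s.2) (k : ℕ) :
    StepRel f g ((advance f g)^[k] s).1 ((advance f g)^[k] s).2 := by
  cases k with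
  | zero => exact hs
  | succ k => rw [Function.iterate_succ_apply']; exact stepRel_advance _

/-- Every neighbor of the vertex reached by a step is either the vertex just left or the next one. -/
theorem eq_or_eq_of_stepRel_advance (hsymm : ∀ u v, StepRel f g u v → StepRel f g v u)
    {s : X × X} (hs : StepRel f g s.1 s.2) {w : X} (hw : StepRel f g s.2 w) :
    w = s.1 ∨ w = (advance f g s).2 := by
  have h := hsymm _ _ hs
  unfold StepRel at h hw
  unfold advance
  dsimp only
  split_ifs <;> grind

theorem eq_or_eq_of_stepRel_iterate (hsymm : ∀ u v, StepRel f g u v → StepRel f g v u)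
    {s : X × X} (hs : StepRel f g s.1 s.2) {k : ℕ} {w : X}
    (hw : StepRel f g ((advance f g)^[k + 1] s).1 w) :
    w = ((advance f g)^[k] s).1 ∨ w = ((advance f g)^[k + 2] s).1 := by
  rw [advance_iterate_succ_fst] at hw
  have := eq_or_eq_of_stepRel_advance hsymm (stepRel_advance_iterate hs k) hw
  rwa [← Function.iterate_succ_apply' (advance f g), ← advance_iterate_succ_fst] at this

theorem reflTransGen_iterate {s : X × X} (hs : StepRel f g s.1 s.2) (k : ℕ) :
    Relation.ReflTransGen (StepRel f g) s.1 ((advance f g)^[k] s).1 := by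
  induction k with
  | zero => exact .refl
  | succ k ih =>
    refine ih.tail ?_
    rw [advance_iterate_succ_fst]
    exact stepRel_advance_iterate hs k

theorem mem_of_reflTransGen {α : Type*} {R : α → α → Prop} {S : Set α}
    (hS : ∀ a ∈ S, ∀ b, R a b → b ∈ S) {a b : α} (ha : a ∈ S) (h : Relation.ReflTransGen R a b) :
    b ∈ S := by
  induction h with
  | refl => exact ha
  | tail _ hbc ih => exact hS _ ih _ hbc

/-- In an infinite component, a walk never traverses the same directed edge twice. -/
theorem advance_iterate_injective (hsymm : ∀ u v, StepRel f g u v → StepRel f g v u)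
    {s : X × X} (hs : StepRel f g s.1 s.2)
    (hinf : {y | Relation.ReflTransGen (StepRel f g) s.1 y}.Infinite) :
    Function.Injective fun k ↦ (advance f g)^[k] s := by
  refine Function.Injective.of_lt_imp_ne fun i j hij heq ↦ hinf ?_
  obtain ⟨p, rfl⟩ := Nat.exists_eq_add_of_lt hij
  have hper (k : ℕ) (hk : i ≤ k) :
      (advance f g)^[k + (p + 1)] s = (advance f g)^[k] s := by
    obtain ⟨m, rfl⟩ := Nat.exists_eq_add_of_le hk
    rw [show i + m + (p + 1) = m + (i + p + 1) by ring, Function.iterate_add_apply, ← heq,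
      ← Function.iterate_add_apply, add_comm]
  set S : Set X := (fun k ↦ ((advance f g)^[k] s).1) '' Icc i (i + p)
  have hmem (k : ℕ) (hk : i ≤ k) : ((advance f g)^[k] s).1 ∈ S := by
    induction k using Nat.strong_induction_on with
    | _ k ih =>
      by_cases h : k ≤ i + p
      · exact ⟨k, ⟨hk, h⟩, rfl⟩
      · have h1 := ih (k - (p + 1)) (by omega) (by omega)
        rwa [← hper (k - (p + 1)) (by omega), Nat.sub_add_cancel (by omega)] at h1
  have hclosed : ∀ a ∈ S, ∀ b, StepRel f g a b → b ∈ S := by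
    rintro _ ⟨k, hk, rfl⟩ b hb
    dsimp only at hb
    rw [← hper k hk.1, ← add_assoc] at hb
    rcases eq_or_eq_of_stepRel_iterate hsymm hs hb with rfl | rfl
    · exact hmem _ (le_trans hk.1 (by omega))
    · exact hmem _ (le_trans hk.1 (by omega))
  have hfin : S.Finite := (finite_Icc i (i + p)).image _
  refine hfin.subset fun y hy ↦ ?_
  have hback : Relation.ReflTransGen (StepRel f g) ((advance f g)^[i] s).1 s.1 :=
    have : Std.Symm (StepRel f g) := ⟨hsymm⟩
    symm (reflTransGen_iterate hs i)
  exact mem_of_reflTransGen hclosed (hmem i le_rfl) (hback.trans hy)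

theorem walkLiminf_iterate (φ : X → ℝ) (s : X × X) (k : ℕ) :
    walkLiminf φ f g ((advance f g)^[k] s) = walkLiminf φ f g s := by
  unfold walkLiminf
  simp_rw [← Function.iterate_add_apply]
  exact liminf_nat_add (fun m ↦ φ ((advance f g)^[m] s).1) k

theorem floor_le_walkLevel (φ : X → ℝ) {s : X × X} (hs : StepRel f g s.1 s.2) :
    ⌊|φ s.1 - walkLiminf φ f g s|⁻¹⌋₊ ≤ walkLevel φ f g s.1 := by
  obtain ⟨u, v⟩ := s
  rcases hs with h | h <;> dsimp only at h <;> subst h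
  · exact le_max_left _ _
  · exact le_max_right _ _

/-- The level is unbounded along every walk in an infinite component. -/
theorem exists_lt_walkLevel_iterate (hsymm : ∀ u v, StepRel f g u v → StepRel f g v u)
    {φ : X → ℝ} (hφ : Function.Injective φ) (hφ01 : ∀ x, φ x ∈ Icc (0 : ℝ) 1)
    {s : X × X} (hs : StepRel f g s.1 s.2)
    (hinf : {y | Relation.ReflTransGen (StepRel f g) s.1 y}.Infinite) (n : ℕ) :
    ∃ k, n < walkLevel φ f g ((advance f g)^[k] s).1 := by
  set u : ℕ → ℝ := fun k ↦ φ ((advance f g)^[k] s).1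
  set l := walkLiminf φ f g s with hl
  have hbelow : IsBoundedUnder (· ≥ ·) atTop u := isBoundedUnder_of ⟨0, fun k ↦ (hφ01 _).1⟩
  have habove : IsBoundedUnder (· ≤ ·) atTop u := isBoundedUnder_of ⟨1, fun k ↦ (hφ01 _).2⟩
  set δ : ℝ := ((n : ℝ) + 1)⁻¹ with hδ
  have hδpos : 0 < δ := by positivity
  have h1 : ∃ᶠ k in atTop, u k < l + δ :=
    frequently_lt_of_liminf_lt habove.isCoboundedUnder_ge (show l < l + δ by linarith)
  have h2 : ∀ᶠ k in atTop, l - δ < u k :=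
    eventually_lt_of_lt_liminf (show l - δ < l by linarith) hbelow
  have h3 : ∀ᶠ k in atTop, u k ≠ l := by
    have hfin : {k | u k = l}.Finite := by
      rcases eq_empty_or_nonempty {k | u k = l} with h | ⟨k₀, hk₀⟩
      · rw [h]; exact finite_empty
      · set c := ((advance f g)^[k₀] s).1
        have : ({(c, f c), (c, g c)} : Set (X × X)).Finite := toFinite _
        refine (this.preimage (advance_iterate_injective hsymm hs hinf).injOn).subset
          fun k hk ↦ ?_
        have hkc : ((advance f g)^[k] s).1 = c := hφ (hk.trans hk₀.symm)
        have hstep := stepRel_advance_iterate hs k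
        rw [hkc] at hstep
        rcases hstep with h | h
        · exact Or.inl (Prod.ext hkc h)
        · exact Or.inr (Prod.ext hkc h)
    rw [← Nat.cofinite_eq_atTop]
    exact hfin.compl_mem_cofinite
  obtain ⟨k, hk1, hk2, hk3⟩ := (h1.and_eventually (h2.and h3)).exists
  refine ⟨k, lt_of_lt_of_le ?_ (floor_le_walkLevel φ (stepRel_advance_iterate hs k))⟩
  rw [walkLiminf_iterate, ← hl, ← Nat.succ_le_iff, Nat.le_floor_iff (by positivity)]
  have hpos : 0 < |u k - l| := abs_pos.2 (sub_ne_zero.2 hk3)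
  have hlt : |u k - l| < δ := abs_lt.2 ⟨by linarith, by linarith⟩
  have := inv_anti₀ hpos hlt.le
  rw [hδ, inv_inv] at this
  push_cast
  exact this

/-- Bounding a function that is unbounded along all walks of infinite components leaves only finite
components. -/
theorem finite_boundedStepRel (hsymm : ∀ u v, StepRel f g u v → StepRel f g v u) {r : X → ℕ}
    (hr : ∀ s : X × X, StepRel f g s.1 s.2 →
      {y | Relation.ReflTransGen (StepRel f g) s.1 y}.Infinite →
      ∀ n, ∃ k, n < r ((advance f g)^[k] s).1) (n : ℕ) (x : X) :
    {y | Relation.ReflTransGen (BoundedStepRel f g r n) x y}.Finite := by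
  by_cases hinf : {y | Relation.ReflTransGen (StepRel f g) x y}.Infinite
  swap
  · exact (not_infinite.1 hinf).subset fun y hy ↦
      Relation.ReflTransGen.mono (fun _ _ h ↦ h.1) _ _ hy
  have hs : StepRel f g (x, f x).1 (x, f x).2 := Or.inl rfl
  have ht : StepRel f g (x, g x).1 (x, g x).2 := Or.inr rfl
  obtain ⟨a, ha⟩ := hr _ hs hinf n
  obtain ⟨b, hb⟩ := hr _ ht hinf n
  set S : Set X := (fun k ↦ ((advance f g)^[k] (x, f x)).1) '' Iic a ∪
    (fun k ↦ ((advance f g)^[k] (x, g x)).1) '' Iic b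
  have key (s : X × X) (hs : StepRel f g s.1 s.2) (hs1 : s.1 = x) (c : ℕ)
      (hc : n < r ((advance f g)^[c] s).1)
      (hsub : ∀ k ≤ c, ((advance f g)^[k] s).1 ∈ S) (k : ℕ) (hk : k ≤ c) (z : X)
      (hz : BoundedStepRel f g r n ((advance f g)^[k] s).1 z) : z ∈ S := by
    have hkc : k ≠ c := by
      rintro rfl
      exact absurd hz.2.1 (not_le.2 hc)
    cases k with
    | zero =>
      have hrx : r x ≤ n := hs1 ▸ hz.2.1
      have ha0 : a ≠ 0 := by rintro rfl; exact absurd hrx (not_le.2 ha)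
      have hb0 : b ≠ 0 := by rintro rfl; exact absurd hrx (not_le.2 hb)
      have hz1 : StepRel f g x z := hs1 ▸ hz.1
      rcases hz1 with rfl | rfl
      · exact Or.inl ⟨1, Nat.one_le_iff_ne_zero.2 ha0, rfl⟩
      · exact Or.inr ⟨1, Nat.one_le_iff_ne_zero.2 hb0, rfl⟩
    | succ k =>
      rcases eq_or_eq_of_stepRel_iterate hsymm hs hz.1 with rfl | rfl
      · exact hsub _ (by omega)
      · exact hsub _ (by omega)
  have hfin : S.Finite := ((finite_Iic a).image _).union ((finite_Iic b).image _)
  refine hfin.subset fun y hy ↦ ?_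
  refine mem_of_reflTransGen (S := S) ?_ (Or.inl ⟨0, Nat.zero_le _, rfl⟩) hy
  rintro _ (⟨k, hk, rfl⟩ | ⟨k, hk, rfl⟩) z hz
  · exact key _ hs rfl a ha (fun k hk ↦ Or.inl ⟨k, hk, rfl⟩) k hk z hz
  · exact key _ ht rfl b hb (fun k hk ↦ Or.inr ⟨k, hk, rfl⟩) k hk z hz

theorem boundedStepRel_mono (r : X → ℕ) {m n : ℕ} (hmn : m ≤ n) {x y : X}
    (h : Relation.ReflTransGen (BoundedStepRel f g r m) x y) :
    Relation.ReflTransGen (BoundedStepRel f g r n) x y :=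
  Relation.ReflTransGen.mono (fun _ _ h ↦ ⟨h.1, h.2.1.trans hmn, h.2.2.trans hmn⟩) _ _ h

theorem reflTransGen_iff_exists_bounded (r : X → ℕ) (x y : X) :
    Relation.ReflTransGen (StepRel f g) x y ↔
      ∃ n, Relation.ReflTransGen (BoundedStepRel f g r n) x y := by
  refine ⟨fun h ↦ ?_, fun ⟨n, h⟩ ↦ Relation.ReflTransGen.mono (fun _ _ h ↦ h.1) _ _ h⟩
  induction h with
  | refl => exact ⟨0, .refl⟩
  | @tail b c _ hbc ih =>
    obtain ⟨n, hn⟩ := ih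
    exact ⟨max n (max (r b) (r c)), (boundedStepRel_mono r (le_max_left _ _) hn).tail
      ⟨hbc, by omega, by omega⟩⟩

end Walk

section Measurability

variable {X : Type} [MeasurableSpace X] {f g : X → X}

theorem measurable_advance [MeasurableEq X] (hf : Measurable f) (hg : Measurable g) :
    Measurable (advance f g) := by
  unfold advance
  refine measurable_snd.prodMk (Measurable.ite ?_ (hg.comp measurable_snd) (hf.comp measurable_snd))
  exact measurableSet_eq_fun (hf.comp measurable_snd) measurable_fst

theorem measurable_walkLevel [MeasurableEq X] {φ : X → ℝ} (hφ : Measurable φ) (hf : Measurable f)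
    (hg : Measurable g) : Measurable (walkLevel φ f g) := by
  have hl : Measurable (walkLiminf φ f g) := Measurable.liminf fun k ↦
    hφ.comp (measurable_fst.comp ((measurable_advance hf hg).iterate k))
  have h1 (h : X → X) (hh : Measurable h) :
      Measurable fun x ↦ ⌊|φ x - walkLiminf φ f g (x, h x)|⁻¹⌋₊ := by
    have : Measurable fun x ↦ |φ x - walkLiminf φ f g (x, h x)| :=
      (hφ.sub (hl.comp (measurable_id.prodMk hh))).abs
    exact this.inv.nat_floor
  exact (h1 f hf).max (h1 g hg)

theorem measurableSet_reflTransGen_boundedStepRel [MeasurableEq X] (hf : Measurable f)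
    (hg : Measurable g) {r : X → ℕ} (hr : Measurable r) (n : ℕ) :
    MeasurableSet {p : X × X | Relation.ReflTransGen (BoundedStepRel f g r n) p.1 p.2} := by
  let pull (h : X → X) (S : Set (X × X)) : Set (X × X) :=
    {p | r p.1 ≤ n} ∩ {p | r (h p.1) ≤ n} ∩ (fun p : X × X ↦ (h p.1, p.2)) ⁻¹' S
  let S : ℕ → Set (X × X) := fun k ↦
    Nat.rec (diagonal X) (fun _ T ↦ pull f T ∪ pull g T) k
  have hpull (h : X → X) (hh : Measurable h) (T : Set (X × X)) (hT : MeasurableSet T) :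
      MeasurableSet (pull h T) :=
    ((measurableSet_le (hr.comp measurable_fst) measurable_const).inter
      (measurableSet_le (hr.comp (hh.comp measurable_fst)) measurable_const)).inter
      (((hh.comp measurable_fst).prodMk measurable_snd) hT)
  have hS (k : ℕ) : MeasurableSet (S k) := by
    induction k with
    | zero => exact measurableSet_eq_fun measurable_fst measurable_snd
    | succ k ih => exact (hpull f hf _ ih).union (hpull g hg _ ih)
  convert MeasurableSet.iUnion hS
  ext ⟨x, y⟩
  rw [mem_iUnion]
  constructor
  · intro h
    change Relation.ReflTransGen _ x y at h
    induction h using Relation.ReflTransGen.head_induction_on with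
    | refl => exact ⟨0, rfl⟩
    | head hab _ ih =>
      obtain ⟨k, hk⟩ := ih
      obtain ⟨rfl | rfl, h1, h2⟩ := hab
      · exact ⟨k + 1, Or.inl ⟨⟨h1, h2⟩, hk⟩⟩
      · exact ⟨k + 1, Or.inr ⟨⟨h1, h2⟩, hk⟩⟩
  · rintro ⟨k, hk⟩
    induction k generalizing x with
    | zero => obtain rfl : x = y := hk; exact .refl
    | succ k ih =>
      rcases hk with ⟨⟨h1, h2⟩, h3⟩ | ⟨⟨h1, h2⟩, h3⟩
      · exact .head ⟨Or.inl rfl, h1, h2⟩ (ih _ h3)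
      · exact .head ⟨Or.inr rfl, h1, h2⟩ (ih _ h3)

/-- A Borel map can be recognized by its graph. -/
theorem measurable_of_measurableSet_graph {Y : Type*} [MeasurableSpace Y] [StandardBorelSpace X]
    [StandardBorelSpace Y] {h : X → Y} (hh : MeasurableSet {p : X × Y | p.2 = h p.1}) :
    Measurable h := by
  intro A hA
  have himage : h ⁻¹' A = Prod.fst '' ({p : X × Y | p.2 = h p.1} ∩ Prod.snd ⁻¹' A) := by
    ext x
    constructor
    · exact fun hx ↦ ⟨(x, h x), ⟨rfl, hx⟩, rfl⟩
    · rintro ⟨⟨x, y⟩, ⟨hxy, hy⟩, rfl⟩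
      exact mem_preimage.2 ((show y = h x from hxy) ▸ hy)
  rw [himage]
  refine (hh.inter (measurable_snd hA)).image_of_measurable_injOn measurable_fst ?_
  rintro ⟨x, y⟩ ⟨hy, _⟩ ⟨x', y'⟩ ⟨hy', _⟩ (rfl : x = x')
  exact Prod.ext rfl (hy.trans hy'.symm)

theorem exists_measurable_unitInterval_injective (X : Type) [MeasurableSpace X]
    [StandardBorelSpace X] :
    ∃ φ : X → ℝ, Measurable φ ∧ Function.Injective φ ∧ ∀ x, φ x ∈ Icc (0 : ℝ) 1 := by
  have h := measurableEmbedding_sigmoid_comp_embeddingReal X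
  exact ⟨fun x ↦ (unitInterval.sigmoid (embeddingReal X x) : ℝ),
    measurable_subtype_coe.comp h.measurable, Subtype.val_injective.comp h.injective,
    fun x ↦ Subtype.property _⟩

/-- A Borel graph of degree at most two is generated by two Borel maps. -/
theorem exists_measurable_stepRel [StandardBorelSpace X] {G : X → X → Prop}
    (hGBorel : MeasurableSet {p : X × X | G p.1 p.2}) (hGdeg : ∀ x, {y | G x y}.encard ≤ 2) :
    ∃ f g : X → X, Measurable f ∧ Measurable g ∧
      ∀ x y, StepRel f g x y ↔ G x y ∨ (y = x ∧ ∀ z, ¬ G x z) := by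
  obtain ⟨φ, hφ, hinj, -⟩ := exists_measurable_unitInterval_injective X
  have hdeg (x a b c : X) (ha : G x a) (hb : G x b) (hc : G x c) : a = b ∨ a = c ∨ b = c := by
    by_contra! hne
    have h3 : ({a, b, c} : Set X).encard = 3 :=
      encard_eq_three.2 ⟨a, b, c, hne.1, hne.2.1, hne.2.2, rfl⟩
    have h4 : ({a, b, c} : Set X) ⊆ {y | G x y} := by
      rintro _ (rfl | rfl | rfl) <;> assumption
    have h5 := (encard_le_encard h4).trans (hGdeg x)
    rw [h3] at h5
    exact absurd h5 (by decide)
  have hfstsnd : Measurable fun p : X × X × X ↦ (p.1, p.2.1) :=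
    measurable_fst.prodMk (measurable_fst.comp measurable_snd)
  have hfstthd : Measurable fun p : X × X × X ↦ (p.1, p.2.2) :=
    measurable_fst.prodMk (measurable_snd.comp measurable_snd)
  let D₂ : Set (X × X × X) := {p | G p.1 p.2.1 ∧ G p.1 p.2.2 ∧ φ p.2.1 < φ p.2.2}
  have hD₂ : MeasurableSet D₂ := (hfstsnd hGBorel).inter ((hfstthd hGBorel).inter
    (measurableSet_lt (hφ.comp (measurable_fst.comp measurable_snd))
      (hφ.comp (measurable_snd.comp measurable_snd))))
  have hD₂inj : InjOn Prod.fst D₂ := by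
    rintro ⟨x, y, z⟩ ⟨h1, h2, h3⟩ ⟨x', y', z'⟩ ⟨h1', h2', h3'⟩ (rfl : x = x')
    dsimp only at *
    have := hdeg x y z y' h1 h2 h1'
    have := hdeg x y z z' h1 h2 h2'
    grind
  have hS₂ : MeasurableSet (Prod.fst '' D₂) := hD₂.image_of_measurable_injOn measurable_fst hD₂inj
  have hS₂iff (x : X) : x ∈ Prod.fst '' D₂ ↔ ∃ y z, G x y ∧ G x z ∧ y ≠ z := by
    constructor
    · rintro ⟨⟨x, y, z⟩, ⟨h1, h2, h3⟩, rfl⟩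
      exact ⟨y, z, h1, h2, fun h ↦ h3.ne (congrArg φ h)⟩
    · rintro ⟨y, z, h1, h2, h3⟩
      rcases lt_or_gt_of_ne (hinj.ne h3) with h | h
      · exact ⟨(x, y, z), ⟨h1, h2, h⟩, rfl⟩
      · exact ⟨(x, z, y), ⟨h2, h1, h⟩, rfl⟩
  let D₁ : Set (X × X) := {p | G p.1 p.2} ∩ Prod.fst ⁻¹' (Prod.fst '' D₂)ᶜ
  have hD₁ : MeasurableSet D₁ := hGBorel.inter (measurable_fst hS₂.compl)
  have hD₁inj : InjOn Prod.fst D₁ := by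
    rintro ⟨x, y⟩ ⟨h1, h2⟩ ⟨x', y'⟩ ⟨h1', h2'⟩ (rfl : x = x')
    by_contra hne
    exact h2 ((hS₂iff x).2 ⟨y, y', h1, h1', fun h ↦ hne (Prod.ext rfl h)⟩)
  have hS₁ : MeasurableSet (Prod.fst '' D₁) := hD₁.image_of_measurable_injOn measurable_fst hD₁inj
  let Γ : Set (X × X × X) := D₂ ∪ ((fun p ↦ (p.1, p.2.1)) ⁻¹' D₁ ∩ {p | p.2.1 = p.2.2}) ∪
    (Prod.fst ⁻¹' (Prod.fst '' D₂ ∪ Prod.fst '' D₁)ᶜ ∩ ({p | p.2.1 = p.1} ∩ {p | p.2.2 = p.1}))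
  have hΓ : MeasurableSet Γ :=
    (hD₂.union ((hfstsnd hD₁).inter (measurableSet_eq_fun (measurable_fst.comp measurable_snd)
      (measurable_snd.comp measurable_snd)))).union
    ((measurable_fst (hS₂.union hS₁).compl).inter
      ((measurableSet_eq_fun (measurable_fst.comp measurable_snd) measurable_fst).inter
        (measurableSet_eq_fun (measurable_snd.comp measurable_snd) measurable_fst)))
  have hexists (x : X) : ∃ q : X × X, (x, q) ∈ Γ := by
    by_cases h2 : x ∈ Prod.fst '' D₂
    · obtain ⟨⟨x, q⟩, hq, rfl⟩ := h2
      exact ⟨q, Or.inl (Or.inl hq)⟩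
    by_cases h1 : x ∈ Prod.fst '' D₁
    · obtain ⟨⟨x, y⟩, hy, rfl⟩ := h1
      exact ⟨(y, y), Or.inl (Or.inr ⟨hy, rfl⟩)⟩
    · exact ⟨(x, x), Or.inr ⟨fun h ↦ h.elim h2 h1, rfl, rfl⟩⟩
  have hunique (x : X) (q q' : X × X) (hq : (x, q) ∈ Γ) (hq' : (x, q') ∈ Γ) : q = q' := by
    rcases hq with (h | ⟨h, h0⟩) | ⟨h, h0, h1⟩ <;>
      rcases hq' with (h' | ⟨h', h0'⟩) | ⟨h', h0', h1'⟩
    · exact congrArg Prod.snd (hD₂inj h h' rfl)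
    · exact absurd ⟨_, h, rfl⟩ h'.2
    · exact absurd (Or.inl ⟨_, h, rfl⟩) h'
    · exact absurd ⟨_, h', rfl⟩ h.2
    · have h2 : q.1 = q'.1 := congrArg Prod.snd (hD₁inj h h' rfl)
      exact Prod.ext h2 (h0.symm.trans (h2.trans h0'))
    · exact absurd (Or.inr ⟨_, h, rfl⟩) h'
    · exact absurd (Or.inl ⟨_, h', rfl⟩) h
    · exact absurd (Or.inr ⟨_, h', rfl⟩) h
    · exact Prod.ext (h0.trans h0'.symm) (h1.trans h1'.symm)
  choose q hq using hexists
  have hqmeas : Measurable q := by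
    refine measurable_of_measurableSet_graph ?_
    convert hΓ
    ext ⟨x, p⟩
    constructor
    · rintro (rfl : p = q x)
      exact hq x
    · exact fun h ↦ hunique x _ _ h (hq x)
  refine ⟨fun x ↦ (q x).1, fun x ↦ (q x).2, measurable_fst.comp hqmeas,
    measurable_snd.comp hqmeas, fun x y ↦ ?_⟩
  unfold StepRel
  dsimp only
  rcases hq x with (⟨h1, h2, h3⟩ | ⟨⟨h1, h2⟩, h3⟩) | ⟨h1, h2, h3⟩
  · dsimp only at h1 h2 h3
    have := hdeg x (q x).1 (q x).2 y h1 h2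
    grind
  · have h2' := mt (hS₂iff x).2 h2
    dsimp only [mem_ofPred_eq] at h1 h3
    push Not at h2'
    have := h2' (q x).1 y h1
    grind
  · have hno (z : X) : ¬ G x z := fun hz ↦ by
      refine h1 ?_
      by_cases hx : x ∈ Prod.fst '' D₂
      · exact Or.inl hx
      · exact Or.inr ⟨(x, z), ⟨hz, hx⟩, rfl⟩
    change (q x).1 = x at h2
    change (q x).2 = x at h3
    grind

end Measurability

/-- If there is a Borel graph on `X` of degree at most `2` whose connected components
are exactly the `E`-classes, then the Borel equivalence relation `E` is hyperfinite. -/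
theorem statement1 {X : Type} [MeasurableSpace X] [StandardBorelSpace X]
    (E : X → X → Prop) (hE : IsBorelEquivRel E)
    (G : X → X → Prop)
    (hGBorel : MeasurableSet {p : X × X | G p.1 p.2})
    (hGsymm : ∀ x y, G x y → G y x)
    (hGirrefl : ∀ x, ¬ G x x)
    (hGdeg : ∀ x, {y | G x y}.encard ≤ 2)
    (hcomp : ∀ x y, E x y ↔ Relation.ReflTransGen G x y) :
    IsHyperfinite E := by
  obtain ⟨f, g, hf, hg, hfg⟩ := exists_measurable_stepRel hGBorel hGdeg
  obtain ⟨φ, hφ, hinj, hφ01⟩ := exists_measurable_unitInterval_injective X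
  have hsymm (u v : X) (h : StepRel f g u v) : StepRel f g v u := by
    rcases (hfg u v).1 h with h1 | ⟨rfl, -⟩
    · exact (hfg v u).2 (Or.inl (hGsymm _ _ h1))
    · exact h
  have hEstep (x y : X) : E x y ↔ Relation.ReflTransGen (StepRel f g) x y := by
    rw [hcomp]
    refine ⟨fun h ↦ Relation.ReflTransGen.mono (fun u v huv ↦ (hfg u v).2 (Or.inl huv)) _ _ h, fun h ↦ ?_⟩
    induction h with
    | refl => exact .refl
    | @tail b c _ hbc ih =>
      rcases (hfg b c).1 hbc with h1 | ⟨rfl, -⟩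
      · exact ih.tail h1
      · exact ih
  set r := walkLevel φ f g
  refine ⟨fun n ↦ Relation.ReflTransGen (BoundedStepRel f g r n), fun n ↦ ⟨⟨⟨fun _ ↦ .refl, ?_,
    fun h h' ↦ h.trans h'⟩, ?_⟩, ?_⟩, fun n x y ↦ boundedStepRel_mono r n.le_succ, fun x y ↦ ?_⟩
  · have : Std.Symm (BoundedStepRel f g r n) := ⟨fun u v h ↦ ⟨hsymm _ _ h.1, h.2.2, h.2.1⟩⟩
    intro x y h
    exact Std.Symm.symm (r := Relation.ReflTransGen (BoundedStepRel f g r n)) x y h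
  · exact measurableSet_reflTransGen_boundedStepRel hf hg (measurable_walkLevel hφ hf hg) n
  · exact finite_boundedStepRel hsymm
      (fun s hs hinf ↦ exists_lt_walkLevel_iterate hsymm hinj hφ01 hs hinf) n
  · rw [hEstep, reflTransGen_iff_exists_bounded r]
end
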